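/- Let ζ: ℝ_{>1}×ℤ_{≥1}→ℝ_{≥0} be a function such that for every r>1 one has ζ(r,n)·(n·log n)^{1/3} → 0 as n → ∞. Then no infinite family of superstars is up-to-ζ fixating; that is, for every infinite set F ⊆ ℤ_{≥1}³ of parameter triples, the family of (k,ℓ,m)-superstars with (k,ℓ,m)∈F is not up-to-ζ fixating. -/

import Mathlib

open Finset

/-- Total fitness of the mutant set `S` (mutants have fitness `r`, non-mutants fitness `1`). -/
noncomputable def moranW {V : Type*} [Fintype V] (r : ℝ) (S : Finset V) : ℝ :=
  r * S.card + ((Fintype.card V : ℝ) - S.card)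

/-- One-step transition probability of the Moran process with fitness `r` and
reproduction weights `w`, from mutant set `S` to mutant set `T`:  a vertex `u` is chosen
with probability `r / moranW r S` if it is a mutant and `1 / moranW r S` otherwise, then a
target `v` is chosen with probability `w u v`, and `v` becomes a mutant if `u` is one and
a non-mutant otherwise. -/
noncomputable def moranStep {V : Type*} [Fintype V] [DecidableEq V]
    (r : ℝ) (w : V → V → ℝ) (S T : Finset V) : ℝ :=
  ∑ u : V, ∑ v : V,
    ((if u ∈ S then r else 1) / moranW r S) * w u v *
      (if (if u ∈ S then insert v S else S.erase v) = T then 1 else 0)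

/-- Distribution of the Moran process after `t` steps, from initial distribution `init`. -/
noncomputable def moranDist {V : Type*} [Fintype V] [DecidableEq V]
    (r : ℝ) (w : V → V → ℝ) (init : Finset V → ℝ) : ℕ → Finset V → ℝ
  | 0 => init
  | t + 1 => fun T => ∑ S : Finset V, moranDist r w init t S * moranStep r w S T

/-- Reproduction weights of the (unweighted) Moran process on the digraph with
out-neighbourhoods `out`: the offspring goes to a uniformly random out-neighbour. -/
noncomputable def outWeights {V : Type*} [DecidableEq V]
    (out : V → Finset V) : V → V → ℝ :=
  fun u v => if v ∈ out u then ((out u).card : ℝ)⁻¹ else 0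

/-- Extinction probability: `sup_t Pr(S_t = ∅)`. -/
noncomputable def extinctionProb {V : Type*} [Fintype V] [DecidableEq V]
    (r : ℝ) (w : V → V → ℝ) (init : Finset V → ℝ) : ℝ :=
  ⨆ t : ℕ, moranDist r w init t (∅ : Finset V)

/-- Fixation probability: `sup_t Pr(S_t = V)`. -/
noncomputable def fixationProb {V : Type*} [Fintype V] [DecidableEq V]
    (r : ℝ) (w : V → V → ℝ) (init : Finset V → ℝ) : ℝ :=
  ⨆ t : ℕ, moranDist r w init t (Finset.univ : Finset V)

/-- Initial distribution: a single mutant at a uniformly random vertex. -/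
noncomputable def uniformSingleton (V : Type*) [Fintype V] [DecidableEq V] :
    Finset V → ℝ :=
  fun S => if S.card = 1 then (Fintype.card V : ℝ)⁻¹ else 0

/-- Initial distribution: a single mutant at the fixed vertex `x₀`. -/
def pointInit {V : Type*} [DecidableEq V] (x₀ : V) : Finset V → ℝ :=
  fun S => if S = {x₀} then 1 else 0

/-- Vertices of the `(k,ℓ,m)`-superstar: `ℓ` reservoirs `R_i` of size `m`
(`Sum.inl (i, x)`), path vertices `v_{i,j}` for `i ∈ [ℓ]`, `j ∈ [k]`
(`Sum.inr (Sum.inl (i, j))`), and the centre vertex `v*` (`Sum.inr (Sum.inr ())`).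
It has `ℓ * (k + m) + 1` vertices. -/
abbrev SuperstarV (k ℓ m : ℕ) : Type :=
  (Fin ℓ × Fin m) ⊕ ((Fin ℓ × Fin k) ⊕ Unit)

/-- Out-neighbourhoods of the `(k,ℓ,m)`-superstar: the centre points to every reservoir
vertex, each vertex of `R_i` points to `v_{i,1}`, each `v_{i,j}` points to `v_{i,j+1}`
for `j < k`, and `v_{i,k}` points to the centre. -/
def superstarOut (k ℓ m : ℕ) : SuperstarV k ℓ m → Finset (SuperstarV k ℓ m)
  | Sum.inl (i, _) =>
      if h : 0 < k then {Sum.inr (Sum.inl (i, ⟨0, h⟩))} else {Sum.inr (Sum.inr ())}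
  | Sum.inr (Sum.inl (i, j)) =>
      if h : (j : ℕ) + 1 < k then {Sum.inr (Sum.inl (i, ⟨(j : ℕ) + 1, h⟩))}
      else {Sum.inr (Sum.inr ())}
  | Sum.inr (Sum.inr _) =>
      (Finset.univ : Finset (Fin ℓ × Fin m)).image fun p => Sum.inl p

/-- The family of `(k,ℓ,m)`-superstars with parameter triples in `F` is up-to-`ζ`
fixating: for every `r > 1` there is an `n₀` such that every superstar in the family
with `n ≥ n₀` vertices has extinction probability at most `ζ r n` for the Moran process
with fitness `r` started from a single uniformly random initial mutant. -/
def UpToZetaFixatingSuperstars (ζ : ℝ → ℕ → ℝ) (F : Set (ℕ × ℕ × ℕ)) : Prop :=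
  ∀ r : ℝ, 1 < r → ∃ n₀ : ℕ, ∀ k ℓ m : ℕ, (k, ℓ, m) ∈ F →
    n₀ ≤ ℓ * (k + m) + 1 →
    extinctionProb r (outWeights (superstarOut k ℓ m))
        (uniformSingleton (SuperstarV k ℓ m)) ≤
      ζ r (ℓ * (k + m) + 1)


section General

set_option linter.unusedSectionVars false

variable {V : Type*} [Fintype V] [DecidableEq V]

/-- Fitness of the vertex `u` in state `S` (with `r = 2`). -/
noncomputable def fit (S : Finset V) (u : V) : ℝ := if u ∈ S then 2 else 1

/-- State after `u` reproduces onto `v`. -/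
def nxt (S : Finset V) (u v : V) : Finset V := if u ∈ S then insert v S else S.erase v

/-- (Unnormalised) generator of the Moran process with `r = 2`. -/
noncomputable def gen (w : V → V → ℝ) (f : Finset V → ℝ) (S : Finset V) : ℝ :=
  ∑ u : V, ∑ v : V, w u v * (fit S u * (f (nxt S u v) - f S))

lemma fit_pos (S : Finset V) (u : V) : 0 < fit S u := by
  unfold fit; split_ifs <;> norm_num

lemma moranW_eq (S : Finset V) : moranW 2 S = ∑ u : V, fit S u := by
  unfold moranW fit
  rw [Finset.sum_ite]
  simp only [Finset.sum_const, nsmul_eq_mul, Finset.filter_mem_eq_inter, Finset.univ_inter]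
  have h2 : (Finset.univ.filter (fun u => u ∉ S)) = Sᶜ := by ext; simp
  rw [h2, Finset.card_compl, Nat.cast_sub (Finset.card_le_univ S)]
  ring

lemma step_sum (w : V → V → ℝ) (S : Finset V) (f : Finset V → ℝ) :
    ∑ T, moranStep 2 w S T * f T
      = ∑ u : V, ∑ v : V, (fit S u / moranW 2 S) * w u v * f (nxt S u v) := by
  unfold moranStep
  simp only [Finset.sum_mul]
  rw [Finset.sum_comm]
  refine Finset.sum_congr rfl fun u _ => ?_
  rw [Finset.sum_comm]
  refine Finset.sum_congr rfl fun v _ => ?_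
  simp [fit, nxt]

lemma step_nonneg (w : V → V → ℝ) (hw : ∀ u v, 0 ≤ w u v) (S T : Finset V) :
    0 ≤ moranStep 2 w S T := by
  unfold moranStep
  have hW : 0 ≤ moranW 2 S := by
    rw [moranW_eq]; exact Finset.sum_nonneg fun u _ => (fit_pos S u).le
  refine Finset.sum_nonneg fun u _ => Finset.sum_nonneg fun v _ => ?_
  have := hw u v
  apply mul_nonneg
  · apply mul_nonneg _ this
    apply div_nonneg _ hW
    split_ifs <;> norm_num
  · split_ifs <;> norm_num

lemma moranW_pos [Nonempty V] (S : Finset V) : 0 < moranW 2 S := by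
  rw [moranW_eq]; exact Finset.sum_pos (fun u _ => fit_pos S u) Finset.univ_nonempty

lemma step_gen [Nonempty V] (w : V → V → ℝ) (hw1 : ∀ u, ∑ v, w u v = 1)
    (S : Finset V) (f : Finset V → ℝ) :
    ∑ T, moranStep 2 w S T * f T = f S + gen w f S / moranW 2 S := by
  rw [step_sum]
  have hW := moranW_pos S
  have h1 : f S = ∑ u : V, ∑ v : V, (fit S u / moranW 2 S) * w u v * f S := by
    have : ∀ u, ∑ v : V, (fit S u / moranW 2 S) * w u v * f S = fit S u / moranW 2 S * f S := by
      intro u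
      rw [← Finset.sum_mul, ← Finset.mul_sum, hw1, mul_one]
    simp only [this]
    rw [← Finset.sum_mul, ← Finset.sum_div, ← moranW_eq, div_self hW.ne', one_mul]
  unfold gen
  refine Eq.trans ?_ (congrArg (· + _) h1.symm)
  rw [Finset.sum_div, ← Finset.sum_add_distrib]
  refine Finset.sum_congr rfl fun u _ => ?_
  rw [Finset.sum_div, ← Finset.sum_add_distrib]
  refine Finset.sum_congr rfl fun v _ => ?_
  field_simp
  ring

/-- Extinction probability by time `t` as a function of the initial state. -/
noncomputable def Uext (w : V → V → ℝ) : ℕ → Finset V → ℝ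
  | 0 => fun S => if S = ∅ then 1 else 0
  | t + 1 => fun S => ∑ T, moranStep 2 w S T * Uext w t T

lemma Uext_le_one [Nonempty V] (w : V → V → ℝ) (hw : ∀ u v, 0 ≤ w u v)
    (hw1 : ∀ u, ∑ v, w u v = 1) (t : ℕ) : ∀ S, Uext w t S ≤ 1 := by
  induction t with
  | zero => intro S; simp only [Uext]; split_ifs <;> norm_num
  | succ t ih =>
    intro S
    have := step_gen w hw1 S (fun _ => 1)
    simp only [gen, sub_self, mul_zero, Finset.sum_const_zero, zero_div, add_zero] at this
    rw [← this]
    exact Finset.sum_le_sum fun T _ => mul_le_mul_of_nonneg_left (ih T) (step_nonneg w hw S T)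

lemma Uext_mono [Nonempty V] (w : V → V → ℝ) (hw : ∀ u v, 0 ≤ w u v)
    (hw1 : ∀ u, ∑ v, w u v = 1) (S : Finset V) : Monotone (fun t => Uext w t S) := by
  apply monotone_nat_of_le_succ
  intro t
  induction t generalizing S with
  | zero =>
    by_cases hS : S = ∅
    · subst hS
      have : Uext w 1 (∅ : Finset V) = 1 := by
        change ∑ T, moranStep 2 w ∅ T * Uext w 0 T = 1
        rw [step_gen w hw1]
        simp [gen, nxt, Uext]
      simp only [zero_add]
      rw [this]; simp [Uext]
    · simp only [Uext, hS, if_false]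
      refine Finset.sum_nonneg fun T _ => mul_nonneg (step_nonneg w hw S T) ?_
      split_ifs <;> norm_num
  | succ t ih =>
    exact Finset.sum_le_sum fun T _ => mul_le_mul_of_nonneg_left (ih T) (step_nonneg w hw S T)

/-- Limit extinction probability as a function of the initial state. -/
noncomputable def uLim (w : V → V → ℝ) (S : Finset V) : ℝ := ⨆ t, Uext w t S

lemma uLim_tendsto [Nonempty V] (w : V → V → ℝ) (hw : ∀ u v, 0 ≤ w u v)
    (hw1 : ∀ u, ∑ v, w u v = 1) (S : Finset V) :
    Filter.Tendsto (fun t => Uext w t S) Filter.atTop (nhds (uLim w S)) :=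
  tendsto_atTop_ciSup (Uext_mono w hw hw1 S)
    ⟨1, by rintro _ ⟨t, rfl⟩; exact Uext_le_one w hw hw1 t S⟩

lemma Uext_le_uLim [Nonempty V] (w : V → V → ℝ) (hw : ∀ u v, 0 ≤ w u v)
    (hw1 : ∀ u, ∑ v, w u v = 1) (t : ℕ) (S : Finset V) : Uext w t S ≤ uLim w S :=
  (Uext_mono w hw hw1 S).ge_of_tendsto (uLim_tendsto w hw hw1 S) t

lemma uLim_step [Nonempty V] (w : V → V → ℝ) (hw : ∀ u v, 0 ≤ w u v)
    (hw1 : ∀ u, ∑ v, w u v = 1) (S : Finset V) :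
    ∑ T, moranStep 2 w S T * uLim w T = uLim w S := by
  have h1 := (uLim_tendsto w hw hw1 S).comp (Filter.tendsto_add_atTop_nat 1)
  have h2 : Filter.Tendsto (fun t => ∑ T, moranStep 2 w S T * Uext w t T) Filter.atTop
      (nhds (∑ T, moranStep 2 w S T * uLim w T)) :=
    tendsto_finsetSum _ fun T _ => (uLim_tendsto w hw hw1 T).const_mul _
  exact tendsto_nhds_unique h2 h1

/-- Maximum principle. -/
lemma uLim_ge [Nonempty V] (w : V → V → ℝ) (hw : ∀ u v, 0 ≤ w u v)
    (hw1 : ∀ u, ∑ v, w u v = 1) (φ : Finset V → ℝ) (h0 : φ ∅ ≤ 1)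
    (h : ∀ S, S ≠ ∅ → 0 < φ S → 0 < gen w φ S) (S : Finset V) : φ S ≤ uLim w S := by
  obtain ⟨S₀, -, hmax⟩ := Finset.exists_max_image (Finset.univ : Finset (Finset V))
    (fun S => φ S - uLim w S) ⟨∅, Finset.mem_univ _⟩
  by_contra hcon
  push Not at hcon
  have hS₀ : 0 < φ S₀ - uLim w S₀ := by
    have := hmax S (Finset.mem_univ _)
    linarith
  have hnn : 0 ≤ uLim w S₀ := by
    refine le_trans ?_ (Uext_le_uLim w hw hw1 0 S₀)
    simp only [Uext]; split_ifs <;> norm_num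
  have hne : S₀ ≠ ∅ := by
    rintro rfl
    have : (1 : ℝ) ≤ uLim w ∅ := by
      refine le_trans ?_ (Uext_le_uLim w hw hw1 0 ∅)
      simp [Uext]
    linarith
  have hg := h S₀ hne (by linarith)
  have e1 := step_gen w hw1 S₀ φ
  have e2 := step_gen w hw1 S₀ (fun _ => φ S₀ - uLim w S₀)
  simp only [gen, sub_self, mul_zero, Finset.sum_const_zero, zero_div, add_zero] at e2
  have e3 := uLim_step w hw hw1 S₀
  have e4 : ∑ T, moranStep 2 w S₀ T * φ T ≤
      ∑ T, moranStep 2 w S₀ T * uLim w T + ∑ T, moranStep 2 w S₀ T * (φ S₀ - uLim w S₀) := by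
    rw [← Finset.sum_add_distrib]
    refine Finset.sum_le_sum fun T _ => ?_
    rw [← mul_add]
    refine mul_le_mul_of_nonneg_left ?_ (step_nonneg w hw S₀ T)
    have := hmax T (Finset.mem_univ _)
    linarith
  have := div_pos hg (moranW_pos S₀)
  linarith

/-- Indicator of the empty state. -/
noncomputable def emp (S : Finset V) : ℝ := if S = ∅ then 1 else 0

/-- Main comparison lemma. -/
lemma uLim_ge_of_Q [Nonempty V] (w : V → V → ℝ) (hw : ∀ u v, 0 ≤ w u v)
    (hw1 : ∀ u, ∑ v, w u v = 1) (a : ℝ) (ha : 0 < a) (ha1 : a ≤ 1)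
    (Q : Finset V → ℝ) (hQ : ∀ S, 0 ≤ Q S)
    (h : ∀ S, S ≠ ∅ → Q S < 1 → a * gen w Q S < (1 - a) * gen w emp S)
    (S : Finset V) : a * (1 - Q S) ≤ uLim w S := by
  let φ : Finset V → ℝ := fun S => max 0 (a * (1 - Q S)) + (1 - a) * emp S
  have hφ0 : φ ∅ ≤ 1 := by
    have : max 0 (a * (1 - Q ∅)) ≤ a := max_le ha.le (by nlinarith [hQ ∅])
    simp only [φ, emp, if_true]
    linarith
  have key := uLim_ge w hw hw1 φ hφ0 (by
    intro S hS hpos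
    have he : emp S = 0 := by simp [emp, hS]
    have hq : 0 < a * (1 - Q S) := by
      simp only [φ, he, mul_zero, add_zero] at hpos
      rcases lt_max_iff.mp hpos with h | h
      · exact absurd h (lt_irrefl _)
      · exact h
    have hq1 : Q S < 1 := by
      by_contra hc
      nlinarith
    have h1 := h S hS hq1
    have h2 : (1 - a) * gen w emp S - a * gen w Q S ≤ gen w φ S := by
      unfold gen
      rw [Finset.mul_sum, Finset.mul_sum, ← Finset.sum_sub_distrib]
      refine Finset.sum_le_sum fun u _ => ?_
      rw [Finset.mul_sum, Finset.mul_sum, ← Finset.sum_sub_distrib]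
      refine Finset.sum_le_sum fun v _ => ?_
      have e : φ S = a * (1 - Q S) := by
        simp only [φ, he, mul_zero, add_zero]; exact max_eq_right hq.le
      have e' : a * (1 - Q (nxt S u v)) + (1 - a) * emp (nxt S u v) ≤ φ (nxt S u v) := by
        simp only [φ]
        have := le_max_right 0 (a * (1 - Q (nxt S u v)))
        linarith
      have e2 : (1 - a) * (emp (nxt S u v) - emp S) - a * (Q (nxt S u v) - Q S)
          ≤ φ (nxt S u v) - φ S := by
        rw [e, he]; linarith
      have := mul_le_mul_of_nonneg_left e2 (mul_nonneg (hw u v) (fit_pos S u).le)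
      linarith
    linarith) S
  refine le_trans ?_ key
  have : 0 ≤ emp S := by unfold emp; split_ifs <;> norm_num
  have h2 := le_max_right 0 (a * (1 - Q S))
  have h3 : 0 ≤ (1 - a) * emp S := mul_nonneg (by linarith) this
  simp only [φ]
  linarith

lemma dist_sum (w : V → V → ℝ) (init : Finset V → ℝ) (s t : ℕ) :
    ∑ S, moranDist 2 w init s S * Uext w t S = ∑ S, init S * Uext w (s + t) S := by
  induction s generalizing t with
  | zero => simp [moranDist]
  | succ s ih =>
    rw [show s + 1 + t = s + (t + 1) by ring, ← ih (t + 1)]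
    simp only [moranDist, Uext, Finset.sum_mul, Finset.mul_sum]
    rw [Finset.sum_comm]
    refine Finset.sum_congr rfl fun S _ => Finset.sum_congr rfl fun T _ => ?_
    ring

lemma ext_ge [Nonempty V] (w : V → V → ℝ) (hw : ∀ u v, 0 ≤ w u v)
    (hw1 : ∀ u, ∑ v, w u v = 1) (B : Finset V) (a : ℝ)
    (hB : ∀ v ∈ B, a ≤ uLim w {v}) :
    B.card * a / Fintype.card V ≤ extinctionProb 2 w (uniformSingleton V) := by
  have hn : (0 : ℝ) < Fintype.card V := by exact_mod_cast Fintype.card_pos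
  have hform : ∀ f : Finset V → ℝ, ∑ S, uniformSingleton V S * f S
      = ∑ v : V, (Fintype.card V : ℝ)⁻¹ * f {v} := by
    intro f
    have hinj : Function.Injective (fun v : V => ({v} : Finset V)) :=
      Finset.singleton_injective
    refine Eq.trans ?_ (Finset.sum_map Finset.univ ⟨_, hinj⟩
      (fun S => (Fintype.card V : ℝ)⁻¹ * f S))
    symm
    refine Finset.sum_subset_zero_on_sdiff (Finset.subset_univ _) ?_ ?_
    · intro S hS
      have : S.card ≠ 1 := by
        intro hc
        obtain ⟨v, rfl⟩ := Finset.card_eq_one.mp hc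
        simp at hS
      simp [uniformSingleton, this]
    · intro S hS
      simp only [Finset.mem_map, Finset.mem_univ, true_and] at hS
      obtain ⟨v, rfl⟩ := hS
      simp [uniformSingleton]
  have hd : ∀ t, moranDist 2 w (uniformSingleton V) t ∅
      = ∑ v : V, (Fintype.card V : ℝ)⁻¹ * Uext w t {v} := by
    intro t
    have := dist_sum w (uniformSingleton V) t 0
    rw [add_zero, hform] at this
    rw [← this]
    simp [Uext]
  have hlim : Filter.Tendsto (fun t => moranDist 2 w (uniformSingleton V) t ∅) Filter.atTop
      (nhds (∑ v : V, (Fintype.card V : ℝ)⁻¹ * uLim w {v})) := by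
    simp only [hd]
    exact tendsto_finsetSum _ fun v _ => (uLim_tendsto w hw hw1 {v}).const_mul _
  have hnn : ∀ v : V, 0 ≤ uLim w {v} := by
    intro v
    refine le_trans ?_ (Uext_le_uLim w hw hw1 0 {v})
    simp [Uext]
  have hle : ∑ v : V, (Fintype.card V : ℝ)⁻¹ * uLim w {v} ≤
      extinctionProb 2 w (uniformSingleton V) := by
    refine le_of_tendsto' hlim fun t => ?_
    refine le_ciSup (f := fun t => moranDist 2 w (uniformSingleton V) t ∅) ?_ t
    exact hlim.bddAbove_range
  refine le_trans ?_ hle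
  calc B.card * a / Fintype.card V = ∑ v ∈ B, (Fintype.card V : ℝ)⁻¹ * a := by
        rw [Finset.sum_const, nsmul_eq_mul]; field_simp
    _ ≤ ∑ v ∈ B, (Fintype.card V : ℝ)⁻¹ * uLim w {v} :=
        Finset.sum_le_sum fun v hv => mul_le_mul_of_nonneg_left (hB v hv) (inv_nonneg.mpr hn.le)
    _ ≤ _ := Finset.sum_le_univ_sum_of_nonneg
        fun v => mul_nonneg (inv_nonneg.mpr hn.le) (hnn v)

/-- Bounding the generator vertex by vertex. -/
lemma gen_le (w : V → V → ℝ) (hw : ∀ u v, 0 ≤ w u v)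
    (hw1 : ∀ u, ∑ v, w u v = 1) (f : Finset V → ℝ) (S : Finset V) (g : V → ℝ)
    (h : ∀ u v, w u v ≠ 0 → fit S u * (f (nxt S u v) - f S) ≤ g u) :
    gen w f S ≤ ∑ u, g u := by
  unfold gen
  refine Finset.sum_le_sum fun u _ => ?_
  calc _ ≤ ∑ v, w u v * g u := by
        refine Finset.sum_le_sum fun v _ => ?_
        by_cases hz : w u v = 0
        · simp [hz]
        · exact mul_le_mul_of_nonneg_left (h u v hz) (hw u v)
    _ = g u := by rw [← Finset.sum_mul, hw1, one_mul]

lemma gen_emp_ge (w : V → V → ℝ) (hw : ∀ u v, 0 ≤ w u v) (S : Finset V) (hS : S ≠ ∅)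
    (u v : V) : w u v * (fit S u * emp (nxt S u v)) ≤ gen w emp S := by
  have he : emp S = 0 := by simp [emp, hS]
  have hnn : ∀ u v, 0 ≤ w u v * (fit S u * (emp (nxt S u v) - emp S)) := by
    intro u v
    refine mul_nonneg (hw u v) (mul_nonneg (fit_pos S u).le ?_)
    rw [he, sub_zero]; unfold emp; split_ifs <;> norm_num
  unfold gen
  calc _ = w u v * (fit S u * (emp (nxt S u v) - emp S)) := by rw [he, sub_zero]
    _ ≤ ∑ v, w u v * (fit S u * (emp (nxt S u v) - emp S)) :=
        Finset.single_le_sum (f := fun v => w u v * (fit S u * (emp (nxt S u v) - emp S)))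
          (fun v _ => hnn u v) (Finset.mem_univ v)
    _ ≤ _ := Finset.single_le_sum
          (f := fun u => ∑ v, w u v * (fit S u * (emp (nxt S u v) - emp S)))
          (fun u _ => Finset.sum_nonneg fun v _ => hnn u v) (Finset.mem_univ u)

lemma gen_emp_nonneg (w : V → V → ℝ) (hw : ∀ u v, 0 ≤ w u v) (S : Finset V) (hS : S ≠ ∅) :
    0 ≤ gen w emp S := by
  have he : emp S = 0 := by simp [emp, hS]
  unfold gen
  refine Finset.sum_nonneg fun u _ => Finset.sum_nonneg fun v _ =>
    mul_nonneg (hw u v) (mul_nonneg (fit_pos S u).le ?_)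
  rw [he, sub_zero]; unfold emp; split_ifs <;> norm_num

lemma gen_add (w : V → V → ℝ) (f g : Finset V → ℝ) (S : Finset V) :
    gen w (fun S => f S + g S) S = gen w f S + gen w g S := by
  unfold gen
  rw [← Finset.sum_add_distrib]
  refine Finset.sum_congr rfl fun u _ => ?_
  rw [← Finset.sum_add_distrib]
  refine Finset.sum_congr rfl fun v _ => ?_
  ring

lemma gen_smul (w : V → V → ℝ) (c : ℝ) (f : Finset V → ℝ) (S : Finset V) :
    gen w (fun S => c * f S) S = c * gen w f S := by
  unfold gen
  simp only [Finset.mul_sum]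
  refine Finset.sum_congr rfl fun u _ => Finset.sum_congr rfl fun v _ => ?_
  ring

/-- Indicator of leaving the allowed set `G`. -/
noncomputable def bad (G S : Finset V) : ℝ := if S ⊆ G then 0 else 1

/-- Indicator of a mutant at `v`. -/
noncomputable def ind (v : V) (S : Finset V) : ℝ := if v ∈ S then 1 else 0

lemma gen_bad_le (w : V → V → ℝ) (hw : ∀ u v, 0 ≤ w u v)
    (hw1 : ∀ u, ∑ v, w u v = 1) (G S : Finset V) (hS : S ⊆ G) (c : V)
    (hG : ∀ u ∈ S, u ≠ c → ∀ v, w u v ≠ 0 → v ∈ G) :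
    gen w (bad G) S ≤ 2 * ind c S := by
  have h0 : bad G S = 0 := by simp [bad, hS]
  refine le_trans (gen_le w hw hw1 (bad G) S (fun u => if u = c then 2 * ind c S else 0) ?_) ?_
  · intro u v huv
    rw [h0, sub_zero]
    by_cases hu : u ∈ S
    · by_cases huc : u = c
      · subst huc
        simp only [fit, ind, hu, if_true]
        unfold bad
        split_ifs <;> norm_num
      · have hv := hG u hu huc v huv
        have : nxt S u v ⊆ G := by
          simp only [nxt, hu, if_true]
          exact Finset.insert_subset hv hS
        simp [bad, this, huc]
    · have : nxt S u v ⊆ G := by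
        simp only [nxt, hu, if_false]
        exact (Finset.erase_subset _ _).trans hS
      simp only [bad, this, if_true, mul_zero]
      unfold ind
      split_ifs <;> norm_num
  · simp

end General

section Superstar

variable {k ℓ m : ℕ}

/-- Weights of the superstar. -/
noncomputable abbrev sw (k ℓ m : ℕ) : SuperstarV k ℓ m → SuperstarV k ℓ m → ℝ :=
  outWeights (superstarOut k ℓ m)

/-- Centre. -/
abbrev cen : SuperstarV k ℓ m := Sum.inr (Sum.inr ())
/-- Reservoir vertex. -/
abbrev res (i : Fin ℓ) (y : Fin m) : SuperstarV k ℓ m := Sum.inl (i, y)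
/-- Path vertex. -/
abbrev pth (i : Fin ℓ) (j : Fin k) : SuperstarV k ℓ m := Sum.inr (Sum.inl (i, j))

lemma sw_nonneg (u v : SuperstarV k ℓ m) : 0 ≤ sw k ℓ m u v := by
  unfold sw outWeights
  split_ifs
  · positivity
  · exact le_rfl

lemma sw_sum (hℓ : 0 < ℓ) (hm : 0 < m) (u : SuperstarV k ℓ m) :
    ∑ v, sw k ℓ m u v = 1 := by
  have hne : (superstarOut k ℓ m u).Nonempty := by
    rcases u with ⟨i, y⟩ | ⟨i, j⟩ | _
    · simp only [superstarOut]; split_ifs <;> simp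
    · simp only [superstarOut]; split_ifs <;> simp
    · simp only [superstarOut, Finset.image_nonempty]
      exact ⟨(⟨0, hℓ⟩, ⟨0, hm⟩), Finset.mem_univ _⟩
  have hc : ((superstarOut k ℓ m u).card : ℝ) ≠ 0 := by
    exact_mod_cast hne.card_pos.ne'
  unfold sw outWeights
  rw [Finset.sum_ite_mem, Finset.univ_inter, Finset.sum_const, nsmul_eq_mul,
    mul_inv_cancel₀ hc]

lemma sw_mem {u v : SuperstarV k ℓ m} (h : sw k ℓ m u v ≠ 0) : v ∈ superstarOut k ℓ m u := by
  by_contra hc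
  exact h (by simp [sw, outWeights, hc])

lemma sw_res (hk : 0 < k) {i : Fin ℓ} {y : Fin m} {v : SuperstarV k ℓ m}
    (h : sw k ℓ m (res i y) v ≠ 0) : v = pth i ⟨0, hk⟩ := by
  have := sw_mem h
  simpa [superstarOut, hk] using this

lemma sw_pth {i : Fin ℓ} {j : Fin k} {v : SuperstarV k ℓ m}
    (h : sw k ℓ m (pth i j) v ≠ 0) :
    (∃ h : (j : ℕ) + 1 < k, v = pth i ⟨j + 1, h⟩) ∨ ((j : ℕ) + 1 = k ∧ v = cen) := by
  have := sw_mem h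
  simp only [superstarOut] at this
  split_ifs at this with hj
  · left; exact ⟨hj, by simpa using this⟩
  · right; exact ⟨by have := j.2; omega, by simpa using this⟩

lemma sw_cen {v : SuperstarV k ℓ m} (h : sw k ℓ m cen v ≠ 0) : ∃ i y, v = res i y := by
  have := sw_mem h
  simp only [superstarOut, Finset.mem_image] at this
  obtain ⟨⟨i, y⟩, -, rfl⟩ := this
  exact ⟨i, y, rfl⟩

lemma sw_cen_res (i : Fin ℓ) (y : Fin m) : sw k ℓ m cen (res i y) = ((ℓ : ℝ) * m)⁻¹ := by
  have h : (res i y : SuperstarV k ℓ m) ∈ superstarOut k ℓ m cen := by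
    simp [superstarOut]
  simp only [sw, outWeights, h, if_true]
  simp only [superstarOut]
  rw [Finset.card_image_of_injective _ Sum.inl_injective]
  simp

lemma sw_pth_one {i : Fin ℓ} {j : Fin k} (h : (j : ℕ) + 1 < k) :
    sw k ℓ m (pth i j) (pth i ⟨j + 1, h⟩) = 1 := by
  simp [sw, outWeights, superstarOut, h]

lemma sw_res_one (hk : 0 < k) {i : Fin ℓ} {y : Fin m} :
    sw k ℓ m (res i y) (pth i ⟨0, hk⟩) = 1 := by
  simp [sw, outWeights, superstarOut, hk]

lemma mem_nxt_of_ne {V : Type*} [DecidableEq V] {S : Finset V} {u v z : V} (h : z ≠ v) :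
    z ∈ nxt S u v ↔ z ∈ S := by
  unfold nxt
  split_ifs <;> simp [h]

lemma mem_nxt_self {V : Type*} [DecidableEq V] {S : Finset V} {u v : V} :
    v ∈ nxt S u v ↔ u ∈ S := by
  unfold nxt
  split_ifs with h <;> simp [h]

lemma ind_nxt_of_ne {V : Type*} [DecidableEq V] {S : Finset V} {u v z : V} (h : z ≠ v) :
    ind z (nxt S u v) = ind z S := by
  unfold ind; simp only [mem_nxt_of_ne h]

lemma ind_nxt_self {V : Type*} [DecidableEq V] {S : Finset V} {u v : V} :
    ind v (nxt S u v) = ind u S := by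
  unfold ind; simp only [mem_nxt_self]

lemma ind_nonneg {V : Type*} [DecidableEq V] (v : V) (S : Finset V) : 0 ≤ ind v S := by
  unfold ind; split_ifs <;> norm_num

/-- Drift of the indicator of the first path vertex. -/
lemma gen_first (hk : 0 < k) (hℓ : 0 < ℓ) (hm : 0 < m) (i : Fin ℓ) (x : Fin m)
    (S : Finset (SuperstarV k ℓ m)) (hS : ∀ y, y ≠ x → res i y ∉ S) :
    gen (sw k ℓ m) (ind (pth i ⟨0, hk⟩)) S ≤
      2 * (1 - ind (pth i ⟨0, hk⟩) S) - (m - 1) * ind (pth i ⟨0, hk⟩) S := by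
  set s := ind (pth i ⟨0, hk⟩ : SuperstarV k ℓ m) S with hs
  have hs01 : s = 0 ∨ s = 1 := by
    rw [hs]; unfold ind; split_ifs <;> simp
  refine le_trans (gen_le _ sw_nonneg (sw_sum hℓ hm) _ S
    (fun u => match u with
      | Sum.inl p => if p.1 = i then (if p.2 = x then 2 * (1 - s) + s else 0) - s else 0
      | Sum.inr _ => 0) ?_) ?_
  · intro u v huv
    rcases u with ⟨i', y⟩ | ⟨i', j⟩ | _
    · have hv := sw_res hk huv
      subst hv
      simp only
      by_cases hi : i' = i
      · subst hi
        rw [ind_nxt_self, ← hs]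
        by_cases hy : y = x
        · subst hy
          simp only [if_true]
          unfold fit ind
          rcases hs01 with h | h <;> rw [h] <;> split_ifs <;> norm_num
        · have := hS y hy
          simp [fit, ind, this, hy]
      · rw [ind_nxt_of_ne (by simp [Ne.symm hi])]
        simp [hi]
    · rw [ind_nxt_of_ne]
      · simp
      · rcases sw_pth huv with ⟨h, rfl⟩ | ⟨h, rfl⟩
        · simp
        · simp
    · obtain ⟨i', y, rfl⟩ := sw_cen huv
      rw [ind_nxt_of_ne (by simp)]
      simp
  · rw [Fintype.sum_sum_type, Fintype.sum_prod_type]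
    simp only [Finset.sum_const_zero, add_zero]
    rw [Finset.sum_eq_single i (by intro b _ hb; simp [hb]) (by simp)]
    simp only [if_true, Finset.sum_sub_distrib, Finset.sum_ite_eq', Finset.mem_univ,
      Finset.sum_const, Finset.card_univ, Fintype.card_fin, nsmul_eq_mul]
    linarith

/-- Drift of the indicator of the centre. -/
lemma gen_cen (hk : 0 < k) (hℓ : 0 < ℓ) (hm : 0 < m) (i : Fin ℓ)
    (S : Finset (SuperstarV k ℓ m)) (hS : ∀ i' j, i' ≠ i → pth i' j ∉ S) :
    gen (sw k ℓ m) (ind cen) S ≤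
      2 * ind (pth i ⟨k - 1, by omega⟩) S - (ℓ - 1) * ind cen S := by
  have hlast : k - 1 < k := by omega
  set e := ind (pth i ⟨k - 1, by omega⟩ : SuperstarV k ℓ m) S with he
  set s := ind (cen : SuperstarV k ℓ m) S with hs
  have hs01 : s = 0 ∨ s = 1 := by
    rw [hs]; unfold ind; split_ifs <;> simp
  refine le_trans (gen_le _ sw_nonneg (sw_sum hℓ hm) _ S
    (fun u => match u with
      | Sum.inr (Sum.inl p) => if p.2 = ⟨k - 1, by omega⟩ then
          (if p.1 = i then 2 * e + s else 0) - s else 0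
      | Sum.inr (Sum.inr _) => 0
      | Sum.inl _ => 0) ?_) ?_
  · intro u v huv
    rcases u with ⟨i', y⟩ | ⟨i', j⟩ | _
    · have hv := sw_res hk huv
      subst hv
      rw [ind_nxt_of_ne (by simp)]
      simp
    · rcases sw_pth huv with ⟨h, rfl⟩ | ⟨h, rfl⟩
      · rw [ind_nxt_of_ne (by simp)]
        have : j ≠ ⟨k - 1, by omega⟩ := by
          intro hc; rw [hc] at h; simp at h; omega
        simp [this]
      · have hj : j = ⟨k - 1, hlast⟩ := by
          apply Fin.ext; simp; omega
        subst hj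
        rw [ind_nxt_self, ← hs]
        simp only [if_true]
        by_cases hi : i' = i
        · subst hi
          simp only [if_true, ← he]
          have he' := he
          unfold fit
          unfold ind at he'
          split_ifs with hh
          · rw [if_pos hh] at he'
            rcases hs01 with h | h <;> rw [h, he'] <;> norm_num
          · rw [if_neg hh] at he'
            rcases hs01 with h | h <;> rw [h, he'] <;> norm_num
        · have := hS i' ⟨k - 1, by omega⟩ hi
          simp [fit, ind, this, hi]
    · obtain ⟨i', y, rfl⟩ := sw_cen huv
      rw [ind_nxt_of_ne (by simp)]
      simp
  · rw [Fintype.sum_sum_type, Fintype.sum_sum_type]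
    simp only [Fintype.sum_prod_type, Finset.sum_const_zero, add_zero, zero_add, Finset.sum_ite_eq', Finset.mem_univ,
      if_true, Finset.sum_sub_distrib,
      Finset.sum_const, Finset.card_univ, Fintype.card_fin, nsmul_eq_mul]
    linarith

/-- Path positions `≥ 1` (0-indexed) of path `i` that are mutants. -/
def pset (i : Fin ℓ) (S : Finset (SuperstarV k ℓ m)) : Finset (Fin k) :=
  Finset.univ.filter fun j => 1 ≤ (j : ℕ) ∧ pth i j ∈ S

/-- Distance of the tail from the end of the path. -/
def tl (i : Fin ℓ) (S : Finset (SuperstarV k ℓ m)) : ℕ :=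
  (pset i S).sup fun j => k - (j : ℕ)

lemma tl_le (i : Fin ℓ) (S : Finset (SuperstarV k ℓ m)) : tl i S ≤ k :=
  Finset.sup_le fun j _ => Nat.sub_le _ _

lemma tl_nxt_le (hk : 0 < k) (i : Fin ℓ) (S : Finset (SuperstarV k ℓ m))
    (u v : SuperstarV k ℓ m) (huv : sw k ℓ m u v ≠ 0)
    (hu : u = pth i ⟨0, hk⟩ → u ∉ S) : tl i (nxt S u v) ≤ tl i S := by
  refine Finset.sup_le fun j hj => ?_
  simp only [pset, Finset.mem_filter, Finset.mem_univ, true_and] at hj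
  obtain ⟨hj1, hj2⟩ := hj
  by_cases hjS : pth i j ∈ S
  · exact Finset.le_sup (f := fun j : Fin k => k - (j : ℕ))
      (by simp [pset, hj1, hjS])
  · have hv : v = pth i j := by
      by_contra hc
      exact hjS ((mem_nxt_of_ne (Ne.symm hc)).mp hj2)
    subst hv
    have huS : u ∈ S := mem_nxt_self.mp hj2
    rcases u with ⟨i', y⟩ | ⟨i', j'⟩ | _
    · have := sw_res hk huv
      simp at this
      rw [this.2] at hj1
      simp at hj1
    · rcases sw_pth huv with ⟨h, h'⟩ | ⟨h, h'⟩
      · simp at h'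
        obtain ⟨rfl, rfl⟩ := h'
        have hj0 : 1 ≤ (j' : ℕ) := by
          by_contra hc
          have : j' = ⟨0, hk⟩ := by apply Fin.ext; simp; omega
          exact hu (by rw [this]) huS
        have := Finset.le_sup (s := pset i S) (f := fun j : Fin k => k - (j : ℕ)) (b := j')
          (by simp [pset, hj0, huS])
        simp only at this ⊢
        unfold tl
        omega
      · simp at h'
    · obtain ⟨_, _, h⟩ := sw_cen huv
      simp at h

lemma gen_tl_one (hk : 0 < k) (hℓ : 0 < ℓ) (hm : 0 < m) (i : Fin ℓ)
    (S : Finset (SuperstarV k ℓ m)) :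
    gen (sw k ℓ m) (fun S => (tl i S : ℝ)) S ≤ 2 * k := by
  refine le_trans (gen_le _ sw_nonneg (sw_sum hℓ hm) _ S
    (fun u => if u = pth i ⟨0, hk⟩ then 2 * k else 0) ?_) (by simp)
  intro u v huv
  by_cases hu : u = pth i ⟨0, hk⟩
  · simp only [hu, if_true]
    have h1 : (tl i (nxt S (pth i ⟨0, hk⟩) v) : ℝ) ≤ k := by exact_mod_cast tl_le _ _
    have h2 : (0 : ℝ) ≤ (tl i S : ℝ) := Nat.cast_nonneg _
    have h3 : (0 : ℝ) ≤ k := Nat.cast_nonneg _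
    unfold fit
    split_ifs <;> linarith
  · simp only [hu, if_false]
    have h1 : (tl i (nxt S u v) : ℝ) ≤ tl i S := by
      exact_mod_cast tl_nxt_le hk i S u v huv (fun h => absurd h hu)
    have := fit_pos S u
    nlinarith

lemma gen_tl_zero (hk : 0 < k) (hℓ : 0 < ℓ) (hm : 0 < m) (i : Fin ℓ)
    (S : Finset (SuperstarV k ℓ m)) (h0 : pth i ⟨0, hk⟩ ∉ S) :
    gen (sw k ℓ m) (fun S => (tl i S : ℝ)) S ≤ 0 := by
  refine le_trans (gen_le _ sw_nonneg (sw_sum hℓ hm) _ S (fun u => 0) ?_) (by simp)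
  intro u v huv
  have h1 : (tl i (nxt S u v) : ℝ) ≤ tl i S := by
    exact_mod_cast tl_nxt_le hk i S u v huv (fun h => h ▸ h0)
  have := fit_pos S u
  nlinarith

lemma gen_tl_neg (hk : 0 < k) (hℓ : 0 < ℓ) (hm : 0 < m) (i : Fin ℓ)
    (S : Finset (SuperstarV k ℓ m)) (h0 : pth i ⟨0, hk⟩ ∉ S) (hA : (pset i S).Nonempty) :
    gen (sw k ℓ m) (fun S => (tl i S : ℝ)) S ≤ -1 := by
  obtain ⟨p, hp, hmin⟩ := Finset.exists_min_image (pset i S) (fun j => (j : ℕ)) hA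
  have hp' := hp
  simp only [pset, Finset.mem_filter, Finset.mem_univ, true_and] at hp'
  obtain ⟨hp1, hpS⟩ := hp'
  have hplt := p.2
  let q : Fin k := ⟨p - 1, by omega⟩
  have hqS : (pth i q : SuperstarV k ℓ m) ∉ S := by
    intro hc
    by_cases hq : 1 ≤ (q : ℕ)
    · have := hmin q (by simp [pset, hc]; exact hq)
      simp [q] at this
      omega
    · have : q = ⟨0, hk⟩ := by apply Fin.ext; simp; omega
      rw [this] at hc
      exact h0 hc
  have htl : k - (p : ℕ) ≤ tl i S :=
    Finset.le_sup (f := fun j : Fin k => k - (j : ℕ)) hp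
  refine le_trans (gen_le _ sw_nonneg (sw_sum hℓ hm) _ S
    (fun u => if u = pth i q then -1 else 0) ?_) (by simp)
  intro u v huv
  by_cases hu : u = pth i q
  · subst hu
    simp only [if_true]
    have hv : v = pth i p := by
      rcases sw_pth huv with ⟨h, h'⟩ | ⟨h, h'⟩
      · rw [h']
        congr 4
        simp [q]
        omega
      · simp [q] at h
        omega
    subst hv
    have h1 : tl i (nxt S (pth i q) (pth i p)) + 1 ≤ tl i S := by
      have : tl i (nxt S (pth i q) (pth i p)) ≤ k - (p : ℕ) - 1 := by
        refine Finset.sup_le fun j hj => ?_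
        simp only [pset, Finset.mem_filter, Finset.mem_univ, true_and] at hj
        obtain ⟨hj1, hj2⟩ := hj
        simp only [nxt, hqS, if_false, Finset.mem_erase] at hj2
        have hjp : j ≠ p := by rintro rfl; exact hj2.1 rfl
        have := hmin j (by simp [pset, hj1, hj2.2])
        have h3 : (j : ℕ) ≠ p := fun h => hjp (Fin.ext h)
        omega
      omega
    have h2 : (tl i (nxt S (pth i q) (pth i p)) : ℝ) + 1 ≤ tl i S := by exact_mod_cast h1
    simp only [fit, hqS, if_false]
    linarith
  · simp only [hu, if_false]
    have h1 : (tl i (nxt S u v) : ℝ) ≤ tl i S := by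
      exact_mod_cast tl_nxt_le hk i S u v huv (fun h => h ▸ h0)
    have := fit_pos S u
    nlinarith

end Superstar

section Cases

variable {k ℓ m : ℕ}

lemma bad_nonneg {V : Type*} [DecidableEq V] (G S : Finset V) : 0 ≤ bad G S := by
  unfold bad; split_ifs <;> norm_num

lemma sub_of_bad {V : Type*} [DecidableEq V] {G S : Finset V} (h : bad G S < 1) : S ⊆ G := by
  by_contra hc
  simp [bad, hc] at h

lemma caseA (hk : 0 < k) (hℓ : 0 < ℓ) (hm : 0 < m) (i : Fin ℓ) (j : Fin k) :
    (1 / 4 : ℝ) ≤ uLim (sw k ℓ m) {pth i j} := by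
  have key := uLim_ge_of_Q (sw k ℓ m) sw_nonneg (sw_sum hℓ hm) (1 / 4) (by norm_num)
    (by norm_num) (bad {pth i j}) (fun S => bad_nonneg _ S) ?_ {pth i j}
  · simpa [bad] using key
  · intro S hS hQ
    have hsub := sub_of_bad hQ
    have hSe : S = {pth i j} := (Finset.subset_singleton_iff.mp hsub).resolve_left hS
    subst hSe
    have h1 := gen_bad_le (sw k ℓ m) sw_nonneg (sw_sum hℓ hm) {pth i j} {pth i j}
      (Finset.Subset.refl _) (pth i j)
      (by intro u hu huc; exact absurd (Finset.mem_singleton.mp hu) huc)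
    have h2 : (1 : ℝ) ≤ gen (sw k ℓ m) emp {pth i j} := by
      by_cases hj : (j : ℕ) = 0
      · have hj' : j = ⟨0, hk⟩ := Fin.ext hj
        have := gen_emp_ge (sw k ℓ m) sw_nonneg {pth i j} hS (res i ⟨0, hm⟩) (pth i j)
        rw [hj'] at this ⊢
        rw [sw_res_one] at this
        simpa [fit, nxt, emp] using this
      · have hjlt := j.2
        have hq : (j : ℕ) - 1 < k := by omega
        have hq1 : ((⟨j - 1, hq⟩ : Fin k) : ℕ) + 1 < k := by simp; omega
        have he : j = ⟨((⟨j - 1, hq⟩ : Fin k) : ℕ) + 1, hq1⟩ := by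
          apply Fin.ext; simp; omega
        have hne : (⟨j - 1, hq⟩ : Fin k) ≠ j := by
          intro h
          have := congrArg Fin.val h
          simp at this
          omega
        have := gen_emp_ge (sw k ℓ m) sw_nonneg {pth i j} hS (pth i ⟨j - 1, hq⟩) (pth i j)
        have hw : sw k ℓ m (pth i ⟨j - 1, hq⟩) (pth i j) = 1 := by
          have h3 := sw_pth_one (m := m) (i := i) (j := ⟨j - 1, hq⟩) hq1
          rw [← he] at h3
          exact h3
        rw [hw] at this
        simpa [fit, nxt, emp, hne] using this
    have h3 : ind (pth i j : SuperstarV k ℓ m) {pth i j} = 1 := by simp [ind]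
    rw [h3] at h1
    linarith

lemma gen_emp_single (hℓ : 0 < ℓ) (hm : 0 < m) (i : Fin ℓ) (x : Fin m) :
    ((ℓ : ℝ) * m)⁻¹ ≤ gen (sw k ℓ m) emp {res i x} := by
  have := gen_emp_ge (sw k ℓ m) sw_nonneg {res i x} (by simp) cen (res i x)
  rw [sw_cen_res] at this
  simpa [fit, nxt, emp] using this

lemma caseC (hk : 0 < k) (hℓ : 0 < ℓ) (hm : 2 ≤ m) (i : Fin ℓ) (x : Fin m) :
    (1 / (1 + 13 * ℓ) : ℝ) ≤ uLim (sw k ℓ m) {res i x} := by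
  have hm0 : 0 < m := by omega
  have hmR : (2 : ℝ) ≤ m := by exact_mod_cast hm
  have hℓR : (1 : ℝ) ≤ ℓ := by exact_mod_cast hℓ
  have hm1 : (0 : ℝ) < m - 1 := by linarith
  set a : ℝ := 1 / (1 + 13 * ℓ) with ha
  have ha0 : 0 < a := by positivity
  have ha1 : a ≤ 1 := by
    rw [ha, div_le_one (by positivity)]; linarith
  have hae : a * (1 + 13 * ℓ) = 1 := by rw [ha]; field_simp
  set v1 : SuperstarV k ℓ m := pth i ⟨0, hk⟩ with hv1
  set G : Finset (SuperstarV k ℓ m) := {res i x, v1} with hG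
  set c1 : ℝ := 3 / (m - 1) with hc1
  have hc10 : 0 < c1 := by positivity
  have hc1e : c1 * (m - 1) = 3 := by rw [hc1]; field_simp
  have key := uLim_ge_of_Q (sw k ℓ m) sw_nonneg (sw_sum hℓ hm0) a ha0 ha1
    (fun S => c1 * ind v1 S + bad G S)
    (fun S => add_nonneg (mul_nonneg hc10.le (ind_nonneg _ _)) (bad_nonneg _ S)) ?_ {res i x}
  · simpa [bad, ind, hG, hv1] using key
  · intro S hS hQ
    have hb : bad G S < 1 := by
      have := mul_nonneg hc10.le (ind_nonneg v1 S)
      linarith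
    have hsub := sub_of_bad hb
    rw [gen_add, gen_smul]
    have h1 := gen_bad_le (sw k ℓ m) sw_nonneg (sw_sum hℓ hm0) G S hsub v1 (by
      intro u hu huc v huv
      have := hsub hu
      simp only [hG, Finset.mem_insert, Finset.mem_singleton] at this
      rcases this with rfl | h
      · have := sw_res hk huv
        simp [hG, hv1, this]
      · exact absurd h huc)
    have h2 := gen_first hk hℓ hm0 i x S (by
      intro y hy hc
      have := hsub hc
      simp [hG, hv1, hy] at this)
    rw [← hv1] at h2
    have h4 := gen_emp_nonneg (sw k ℓ m) sw_nonneg S hS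
    by_cases hs : v1 ∈ S
    · have hi : ind v1 S = 1 := by simp [ind, hs]
      rw [hi] at h1 h2
      have h3 := mul_le_mul_of_nonneg_left h2 hc10.le
      have h5 : c1 * gen (sw k ℓ m) (ind v1) S + gen (sw k ℓ m) (bad G) S ≤ -1 := by linarith
      have h6 : 0 ≤ (1 - a) * gen (sw k ℓ m) emp S := mul_nonneg (by linarith) h4
      nlinarith
    · have hSe : S = {res i x} := by
        refine (Finset.subset_singleton_iff.mp ?_).resolve_left hS
        intro u hu
        have := hsub hu
        simp only [hG, Finset.mem_insert, Finset.mem_singleton] at this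
        rcases this with h | h
        · simp [h]
        · exact absurd (h ▸ hu) hs
      have hi : ind v1 S = 0 := by simp [ind, hs]
      rw [hi] at h1 h2
      have h3 := mul_le_mul_of_nonneg_left h2 hc10.le
      have h7 := gen_emp_single (k := k) hℓ hm0 i x
      rw [← hSe] at h7
      have h8 := mul_le_mul_of_nonneg_left h7 (show 0 ≤ 1 - a by linarith)
      have h9 : a * (c1 * 2) < (1 - a) * ((ℓ : ℝ) * m)⁻¹ := by
        have e1 : 1 - a = 13 * ℓ * a := by linarith
        rw [e1, hc1]
        have e2 : 13 * (ℓ : ℝ) * a * ((ℓ : ℝ) * m)⁻¹ = a * (13 / m) := by field_simp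
        rw [e2]
        apply mul_lt_mul_of_pos_left _ ha0
        rw [div_mul_eq_mul_div, div_lt_div_iff₀ hm1 (by linarith)]
        linarith
      have h10 : a * (c1 * gen (sw k ℓ m) (ind v1) S + gen (sw k ℓ m) (bad G) S)
          ≤ a * (c1 * 2) := mul_le_mul_of_nonneg_left (by linarith) ha0.le
      linarith

set_option maxHeartbeats 1000000 in
lemma caseB (hk : 0 < k) (hℓ : 2 ≤ ℓ) (hm : 79 * k + 1 ≤ m) (i : Fin ℓ) (x : Fin m) :
    (1 / (1 + 313 * k) : ℝ) ≤ uLim (sw k ℓ m) {res i x} := by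
  classical
  have hm0 : 0 < m := by omega
  have hℓ0 : 0 < ℓ := by omega
  have hmR : (79 : ℝ) * k + 1 ≤ m := by exact_mod_cast hm
  have hkR : (1 : ℝ) ≤ k := by exact_mod_cast hk
  have hℓR : (2 : ℝ) ≤ ℓ := by exact_mod_cast hℓ
  have hm1 : (0 : ℝ) < m - 1 := by linarith
  have hℓ1 : (0 : ℝ) < ℓ - 1 := by linarith
  set a : ℝ := 1 / (1 + 313 * k) with ha
  have ha0 : 0 < a := by positivity
  have ha1 : a ≤ 1 := by
    rw [ha, div_le_one (by positivity)]; linarith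
  have hae : a * (1 + 313 * k) = 1 := by rw [ha]; field_simp
  set v1 : SuperstarV k ℓ m := pth i ⟨0, hk⟩ with hv1
  set G : Finset (SuperstarV k ℓ m) :=
    Finset.univ.filter (fun u => u = res i x ∨ (∃ j, u = pth i j) ∨ u = cen) with hG
  set c3 : ℝ := 3 / (ℓ - 1) with hc3
  have hc30 : 0 < c3 := by positivity
  have hc3e : c3 * (ℓ - 1) = 3 := by rw [hc3]; field_simp
  have hc33 : c3 ≤ 3 := by rw [hc3, div_le_iff₀ hℓ1]; linarith
  set c1 : ℝ := 13 * k * c3 / (m - 1) with hc1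
  have hc10 : 0 < c1 := by positivity
  have hc1e : c1 * (m - 1) = 13 * k * c3 := by rw [hc1]; field_simp
  have hc1c3 : c1 * 6 < c3 := by
    rw [hc1, div_mul_eq_mul_div, div_lt_iff₀ hm1]
    nlinarith
  have key := uLim_ge_of_Q (sw k ℓ m) sw_nonneg (sw_sum hℓ0 hm0) a ha0 ha1
    (fun S => c1 * ind v1 S + ((4 * c3) * (tl i S : ℝ) + (c3 * ind cen S + bad G S)))
    (fun S => by
      have := ind_nonneg v1 S
      have := ind_nonneg (cen : SuperstarV k ℓ m) S
      have := bad_nonneg G S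
      positivity) ?_ {res i x}
  · have e1 : ind v1 {res i x} = 0 := by simp [ind, hv1]
    have e2 : ind (cen : SuperstarV k ℓ m) {res i x} = 0 := by simp [ind]
    have e3 : tl i ({res i x} : Finset (SuperstarV k ℓ m)) = 0 := by
      simp [tl, pset]
    have e4 : bad G {res i x} = 0 := by simp [bad, hG]
    rw [e1, e2, e3, e4] at key
    simpa using key
  · intro S hS hQ
    have hb : bad G S < 1 := by
      have := ind_nonneg v1 S
      have := ind_nonneg (cen : SuperstarV k ℓ m) S
      have : 0 ≤ c1 * ind v1 S + ((4 * c3) * (tl i S : ℝ) + c3 * ind cen S) := by positivity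
      linarith
    have hsub := sub_of_bad hb
    have hmem : ∀ u ∈ S, u = res i x ∨ (∃ j, u = pth i j) ∨ u = cen := by
      intro u hu
      have := hsub hu
      simpa only [hG, Finset.mem_filter, Finset.mem_univ, true_and] using this
    rw [gen_add, gen_add, gen_add, gen_smul, gen_smul, gen_smul]
    have h1 := gen_bad_le (sw k ℓ m) sw_nonneg (sw_sum hℓ0 hm0) G S hsub cen (by
      intro u hu huc v huv
      simp only [hG, Finset.mem_filter, Finset.mem_univ, true_and]
      rcases hmem u hu with rfl | ⟨j, rfl⟩ | h
      · exact Or.inr (Or.inl ⟨_, sw_res hk huv⟩)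
      · rcases sw_pth huv with ⟨h, rfl⟩ | ⟨h, rfl⟩
        · exact Or.inr (Or.inl ⟨_, rfl⟩)
        · exact Or.inr (Or.inr rfl)
      · exact absurd h huc)
    have h2 := gen_first hk hℓ0 hm0 i x S (by
      intro y hy hc
      have := hmem _ hc
      simp [hy] at this)
    have h3 := gen_cen hk hℓ0 hm0 i S (by
      intro i' j hi hc
      have := hmem _ hc
      simp [hi] at this)
    rw [← hv1] at h2
    have h4 := gen_emp_nonneg (sw k ℓ m) sw_nonneg S hS
    have h6 : 0 ≤ (1 - a) * gen (sw k ℓ m) emp S := mul_nonneg (by linarith) h4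
    have hlast : (pth i ⟨k - 1, by omega⟩ : SuperstarV k ℓ m) ∈ S →
        v1 ∈ S ∨ (pset i S).Nonempty := by
      intro h
      by_cases hk1 : k = 1
      · subst hk1
        exact Or.inl h
      · right
        refine ⟨⟨k - 1, by omega⟩, ?_⟩
        simp only [pset, Finset.mem_filter, Finset.mem_univ, true_and]
        exact ⟨by omega, h⟩
    set e := ind (pth i ⟨k - 1, by omega⟩ : SuperstarV k ℓ m) S with he
    have he1 : e ≤ 1 := by rw [he]; unfold ind; split_ifs <;> norm_num
    have he0 : 0 ≤ e := ind_nonneg _ _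
    set c := ind (cen : SuperstarV k ℓ m) S with hc
    have hc0 : 0 ≤ c := ind_nonneg _ _
    have h2' := mul_le_mul_of_nonneg_left h2 hc10.le
    have h3' := mul_le_mul_of_nonneg_left h3 hc30.le
    have hce : c3 * ((ℓ - 1) * c) = 3 * c := by rw [← mul_assoc, hc3e]
    have hkc : c3 ≤ k * c3 := by nlinarith
    have hee : c3 * e ≤ c3 := by nlinarith
    have suff : ∀ D : ℝ, D < 0 → c1 * gen (sw k ℓ m) (ind v1) S +
        ((4 * c3) * gen (sw k ℓ m) (fun S => (tl i S : ℝ)) S +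
          (c3 * gen (sw k ℓ m) (ind cen) S + gen (sw k ℓ m) (bad G) S)) ≤ D →
        a * (c1 * gen (sw k ℓ m) (ind v1) S +
        ((4 * c3) * gen (sw k ℓ m) (fun S => (tl i S : ℝ)) S +
          (c3 * gen (sw k ℓ m) (ind cen) S + gen (sw k ℓ m) (bad G) S))) <
          (1 - a) * gen (sw k ℓ m) emp S := by
      intro D hD hle
      have := mul_le_mul_of_nonneg_left hle ha0.le
      have := mul_neg_of_pos_of_neg ha0 hD
      linarith
    by_cases hs : v1 ∈ S
    · have hi : ind v1 S = 1 := by simp [ind, hs]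
      rw [hi] at h2'
      have h5 := mul_le_mul_of_nonneg_left (gen_tl_one hk hℓ0 hm0 i S)
        (show 0 ≤ 4 * c3 by positivity)
      have hkc0 : 0 < k * c3 := by positivity
      have h2'' : c1 * (2 * (1 - 1) - ((m : ℝ) - 1) * 1) = -(13 * (k * c3)) := by linarith
      rw [h2''] at h2'
      refine suff (-(k * c3)) (by linarith) ?_
      linarith
    · have hi : ind v1 S = 0 := by simp [ind, hs]
      rw [hi] at h2'
      by_cases hA : (pset i S).Nonempty
      · have h5 := mul_le_mul_of_nonneg_left (gen_tl_neg hk hℓ0 hm0 i S hs hA)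
          (show 0 ≤ 4 * c3 by positivity)
        refine suff (2 * c1 - c3) (by linarith) ?_
        linarith
      · have hez : e = 0 := by
          rw [he]
          unfold ind
          rw [if_neg]
          intro h
          rcases hlast h with h | h
          · exact hs h
          · exact hA h
        rw [hez] at h3'
        have h5 := mul_le_mul_of_nonneg_left (gen_tl_zero hk hℓ0 hm0 i S hs)
          (show 0 ≤ 4 * c3 by positivity)
        by_cases hcS : (cen : SuperstarV k ℓ m) ∈ S
        · have hc1' : c = 1 := by rw [hc]; simp [ind, hcS]
          rw [hc1'] at h3' h1 hce
          refine suff (2 * c1 - 1) (by linarith) ?_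
          linarith
        · have hcz : c = 0 := by rw [hc]; simp [ind, hcS]
          rw [hcz] at h3' h1 hce
          have hSe : S = {res i x} := by
            refine (Finset.subset_singleton_iff.mp ?_).resolve_left hS
            intro u hu
            rcases hmem u hu with h | ⟨j, h⟩ | h
            · simp [h]
            · exfalso
              by_cases hj : (j : ℕ) = 0
              · have hj' : j = ⟨0, hk⟩ := Fin.ext hj
                rw [h, hj'] at hu
                exact hs hu
              · apply hA
                refine ⟨j, ?_⟩
                simp only [pset, Finset.mem_filter, Finset.mem_univ, true_and]
                exact ⟨by omega, h ▸ hu⟩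
            · exact absurd (h ▸ hu) hcS
          have h7 := gen_emp_single (k := k) hℓ0 hm0 i x
          rw [← hSe] at h7
          have h8 := mul_le_mul_of_nonneg_left h7 (show 0 ≤ 1 - a by linarith)
          have h9 : a * (c1 * 2) < (1 - a) * ((ℓ : ℝ) * m)⁻¹ := by
            have e1 : 1 - a = 313 * k * a := by linarith
            have hc1' : c1 * 2 = 78 * k / ((m - 1) * (ℓ - 1)) := by
              rw [hc1, hc3]; field_simp; ring
            rw [e1, hc1']
            have e2 : 313 * (k : ℝ) * a * ((ℓ : ℝ) * m)⁻¹ = a * (313 * k / (ℓ * m)) := by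
              field_simp
            rw [e2]
            apply mul_lt_mul_of_pos_left _ ha0
            have hm2 : (2 : ℝ) ≤ m := by linarith
            have q1 : (ℓ : ℝ) * m ≤ 4 * ((m - 1) * (ℓ - 1)) := by nlinarith
            rw [div_lt_div_iff₀ (by positivity) (by nlinarith)]
            have q2 : 0 < (k : ℝ) * ((m - 1) * (ℓ - 1)) := by positivity
            have q3 := mul_le_mul_of_nonneg_left q1 (show (0 : ℝ) ≤ k by linarith)
            nlinarith
          have h10 : a * (c1 * gen (sw k ℓ m) (ind v1) S +
              ((4 * c3) * gen (sw k ℓ m) (fun S => (tl i S : ℝ)) S +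
              (c3 * gen (sw k ℓ m) (ind cen) S + gen (sw k ℓ m) (bad G) S)))
              ≤ a * (c1 * 2) := mul_le_mul_of_nonneg_left (by linarith) ha0.le
          linarith

end Cases

section Final

lemma card_superstar (k ℓ m : ℕ) : Fintype.card (SuperstarV k ℓ m) = ℓ * (k + m) + 1 := by
  simp; ring

lemma ext_path {k ℓ m : ℕ} (hk : 0 < k) (hℓ : 0 < ℓ) (hm : 0 < m) :
    ((ℓ : ℝ) * k) * (1 / 4) / ((ℓ * (k + m) + 1 : ℕ) : ℝ) ≤
      extinctionProb 2 (sw k ℓ m) (uniformSingleton (SuperstarV k ℓ m)) := by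
  have := ext_ge (sw k ℓ m) sw_nonneg (sw_sum hℓ hm)
    ((Finset.univ : Finset (Fin ℓ × Fin k)).map
      ⟨fun p => Sum.inr (Sum.inl p), fun a b h => by simpa using h⟩) (1 / 4) (by
      intro v hv
      simp only [Finset.mem_map, Finset.mem_univ, true_and] at hv
      obtain ⟨⟨i, j⟩, rfl⟩ := hv
      exact caseA hk hℓ hm i j)
  rw [card_superstar, Finset.card_map] at this
  simpa using this

lemma ext_res {k ℓ m : ℕ} (hℓ : 0 < ℓ) (hm : 0 < m) (a : ℝ)
    (h : ∀ (i : Fin ℓ) (x : Fin m), a ≤ uLim (sw k ℓ m) {res i x}) :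
    ((ℓ : ℝ) * m) * a / ((ℓ * (k + m) + 1 : ℕ) : ℝ) ≤
      extinctionProb 2 (sw k ℓ m) (uniformSingleton (SuperstarV k ℓ m)) := by
  have := ext_ge (sw k ℓ m) sw_nonneg (sw_sum hℓ hm)
    ((Finset.univ : Finset (Fin ℓ × Fin m)).map ⟨Sum.inl, Sum.inl_injective⟩) a (by
      intro v hv
      simp only [Finset.mem_map, Finset.mem_univ, true_and] at hv
      obtain ⟨⟨i, j⟩, rfl⟩ := hv
      exact h i j)
  rw [card_superstar, Finset.card_map] at this
  simpa using this

lemma ext_lower {k ℓ m : ℕ} (hk : 0 < k) (hℓ : 0 < ℓ) (hm : 0 < m) (y : ℝ) (hy : 2 ≤ y)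
    (hyn : y ^ 3 = ((ℓ * (k + m) + 1 : ℕ) : ℝ)) :
    1 / 1000 ≤ extinctionProb 2 (sw k ℓ m) (uniformSingleton (SuperstarV k ℓ m)) * y := by
  by_contra hcon
  push Not at hcon
  set E := extinctionProb 2 (sw k ℓ m) (uniformSingleton (SuperstarV k ℓ m)) with hE
  have hA := ext_path hk hℓ hm
  rw [← hE] at hA
  have hkR : (1 : ℝ) ≤ k := by exact_mod_cast hk
  have hℓR : (1 : ℝ) ≤ ℓ := by exact_mod_cast hℓ
  have hmR : (1 : ℝ) ≤ m := by exact_mod_cast hm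
  have hn : ((ℓ * (k + m) + 1 : ℕ) : ℝ) = ℓ * (k + m) + 1 := by push_cast; ring
  rw [hn] at hA hyn
  have hn0 : (0 : ℝ) < ℓ * (k + m) + 1 := by positivity
  have hn2 : (ℓ : ℝ) * (k + m) + 1 ≤ 2 * (ℓ * (k + m)) := by nlinarith
  have hm62 : 62 * k * y ≤ m := by
    rw [div_le_iff₀ hn0] at hA
    have h1 := mul_le_mul_of_nonneg_right hA (show 0 ≤ y by linarith)
    have h2 : E * (ℓ * (k + m) + 1) * y ≤ 1 / 1000 * (ℓ * (k + m) + 1) := by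
      nlinarith
    have h3 : ℓ * (k * (1 / 4) * y) ≤ (ℓ : ℝ) * (1 / 500 * (k + m)) := by nlinarith
    have h4 := le_of_mul_le_mul_left h3 (by linarith)
    nlinarith
  have hmk : 124 * (k : ℝ) ≤ m := by nlinarith
  have hmkN : 124 * k ≤ m := by exact_mod_cast hmk
  have hn4 : (ℓ : ℝ) * (k + m) + 1 ≤ 4 * (ℓ * m) := by nlinarith
  have hres : ∀ a : ℝ, 0 ≤ a → (ℓ : ℝ) * m * a / (ℓ * (k + m) + 1) ≤ E →
      a * y ≤ 1 / 250 := by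
    intro a ha h
    rw [div_le_iff₀ hn0] at h
    have h1 := mul_le_mul_of_nonneg_right h (show 0 ≤ y by linarith)
    have h2 : E * (ℓ * (k + m) + 1) * y ≤ 1 / 1000 * (ℓ * (k + m) + 1) := by
      nlinarith
    have h3 : ((ℓ : ℝ) * m) * (a * y) ≤ ((ℓ : ℝ) * m) * (1 / 250) := by nlinarith
    exact le_of_mul_le_mul_left h3 (by positivity)
  have hC := ext_res hℓ hm _ (caseC (k := k) hk hℓ (m := m) (by omega))
  rw [hn, ← hE] at hC
  have hC2 := hres _ (by positivity) hC
  rw [div_mul_eq_mul_div, div_le_iff₀ (by positivity)] at hC2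
  have hℓy : 17 * y ≤ ℓ := by linarith
  have hℓ2 : 2 ≤ ℓ := by
    have : (2 : ℝ) ≤ ℓ := by linarith
    exact_mod_cast this
  have hB := ext_res hℓ hm _ (caseB hk hℓ2 (m := m) (by omega))
  rw [hn, ← hE] at hB
  have hB2 := hres _ (by positivity) hB
  rw [div_mul_eq_mul_div, div_le_iff₀ (by positivity)] at hB2
  have hky : y / 2 ≤ k := by linarith
  have p1 : 31 * y * y ≤ m := by nlinarith
  have p2 : 17 * y * (31 * y * y) ≤ (ℓ : ℝ) * m :=
    mul_le_mul hℓy p1 (by positivity) (by linarith)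
  nlinarith [pow_pos (show 0 < y by linarith) 3]

end Final

/-- **No superstar family is too strongly amplifying** (Theorem 1.6).  If
`ζ : ℝ_{>1} × ℤ_{≥1} → ℝ_{≥0}` satisfies `ζ(r,n)·(n log n)^{1/3} → 0` as `n → ∞` for
every `r > 1`, then no infinite family of superstars is up-to-`ζ` fixating. -/
theorem no_superstar_family_up_to_zeta_fixating
    (ζ : ℝ → ℕ → ℝ) (hζnonneg : ∀ r n, 0 ≤ ζ r n)
    (hζ : ∀ r : ℝ, 1 < r →
      Filter.Tendsto (fun n : ℕ => ζ r n * ((n : ℝ) * Real.log (n : ℝ)) ^ ((1 : ℝ) / 3))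
        Filter.atTop (nhds 0))
    (F : Set (ℕ × ℕ × ℕ)) (hF : F.Infinite)
    (hF1 : ∀ p ∈ F, 1 ≤ p.1 ∧ 1 ≤ p.2.1 ∧ 1 ≤ p.2.2) :
    ¬ UpToZetaFixatingSuperstars ζ F := by
  intro hfix
  obtain ⟨n₀, hn₀⟩ := hfix 2 (by norm_num)
  have h1 := (hζ 2 (by norm_num)).eventually (gt_mem_nhds (show (0 : ℝ) < 1 / 1000 by norm_num))
  obtain ⟨n₁, hn₁⟩ := Filter.eventually_atTop.mp h1
  set N := max (max n₀ n₁) 8 with hN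
  have hex : ∃ p ∈ F, N ≤ p.2.1 * (p.1 + p.2.2) + 1 := by
    by_contra hc
    push Not at hc
    apply hF
    refine ((Set.finite_Iic N).prod ((Set.finite_Iic N).prod (Set.finite_Iic N))).subset ?_
    rintro ⟨k, ℓ, m⟩ hp
    have h2 := hc _ hp
    obtain ⟨a1, a2, a3⟩ := hF1 _ hp
    simp only at h2 a1 a2 a3
    simp only [Set.mem_prod, Set.mem_Iic]
    refine ⟨?_, ?_, ?_⟩ <;> nlinarith
  obtain ⟨⟨k, ℓ, m⟩, hp, hNp⟩ := hex
  obtain ⟨hk, hℓ, hm⟩ := hF1 _ hp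
  simp only at hNp hk hℓ hm
  set n := ℓ * (k + m) + 1 with hn
  have hE := hn₀ k ℓ m hp (by omega)
  have hZ := hn₁ n (by omega)
  rw [← hn] at hE
  have hn8 : (8 : ℝ) ≤ n := by
    have : 8 ≤ n := by omega
    exact_mod_cast this
  have hlog : 1 ≤ Real.log n := by
    rw [Real.le_log_iff_exp_le (by linarith)]
    linarith [Real.exp_one_lt_d9]
  set y : ℝ := (n : ℝ) ^ ((1 : ℝ) / 3) with hy
  have hy3 : y ^ 3 = n := by
    rw [hy, ← Real.rpow_natCast, ← Real.rpow_mul (by linarith)]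
    norm_num
  have hy0 : 0 ≤ y := by rw [hy]; positivity
  have hy2 : 2 ≤ y := by
    by_contra hc
    push Not at hc
    have : y ^ 3 < 2 ^ 3 := pow_lt_pow_left₀ hc hy0 (by norm_num)
    rw [hy3] at this
    linarith
  have hyle : y ≤ ((n : ℝ) * Real.log n) ^ ((1 : ℝ) / 3) := by
    rw [hy]
    apply Real.rpow_le_rpow (by linarith) _ (by norm_num)
    nlinarith
  have hlow := ext_lower hk hℓ hm y hy2 hy3
  have h5 := mul_le_mul_of_nonneg_right hE hy0
  have h6 := mul_le_mul_of_nonneg_left hyle (hζnonneg 2 n)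
  have h7 : extinctionProb 2 (sw k ℓ m) (uniformSingleton (SuperstarV k ℓ m)) * y ≤ ζ 2 n * y := h5
  linarith
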